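/- arXiv:2405.16674 — 4 statements merged into one kernel-verified Lean document; each statement's English description precedes it below -/
import Mathlib

section
/- Let n, d, p, m be positive integers with n ≥ 2 and set R = n·log₂ n − (d² + d)·p; assume R ≥ 0. Fix a finite set S ⊆ ℝ with |S| ≤ 2^p. Consider an SSM layer with embedding dimension d over token space ℝ^m, given by (input-dependent) maps A : ℝ^m → Matrix (Fin d) (Fin d) ℝ and B : ℝ^m → Matrix (Fin d) (Fin m) ℝ, together with arbitrary token-embedding maps u, v : Fin n × Fin n → ℝ^m (encoding the sentences 'g(i) = j' and 'f(i) = j'), w₀ : Fin n → ℝ^m (encoding the argument), a query token w_q ∈ ℝ^m, and an arbitrary readout map dec : (Fin d → ℝ) → Fin n. For functions f, g : Fin n → Fin n and an argument x ∈ Fin n, form the prompt t₀ = w₀(x), tᵢ = u(i, g(i)) for i ∈ [1, n], t_{n+i} = v(i, f(i)) for i ∈ [1, n], t_{2n+1} = w_q, and run the recurrence h_{−1} = 0, h_t = A(t_t)·h_{t−1} + B(t_t)·t_t for t = 0, …, 2n+1; the model's answer is dec(h_{2n+1}). Assume the finite-precision condition: for every f : Fin n → Fin n, every entry of the matrix 𝒜(f)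 = A(t_{2n})·A(t_{2n−1})⋯A(t_{n+1}) and of the vector b(f) = Σ_{i=1}^{n} (A(t_{2n})⋯A(t_{n+i+1}))·B(t_{n+i})·t_{n+i} lies in S (these quantities depend only on f). Then for every bijection g : Fin n → Fin n, if f is sampled uniformly at random from the functions Fin n → Fin n and x uniformly from Fin n, the probability that dec(h_{2n+1}) ≠ f(g(x)) is at least R/(3·n·log₂ n). -/
open Matrix Finset

/-- The prompt of the function composition problem: token `0` encodes the
argument `x`, tokens `1, …, n` encode `g`, tokens `n+1, …, 2n` encode `f`,
and token `2n+1` (and beyond) is the query token. -/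
def fcPrompt (n m : ℕ) (u v : Fin n × Fin n → Fin m → ℝ)
    (w0 : Fin n → Fin m → ℝ) (wq : Fin m → ℝ)
    (f g : Fin n → Fin n) (x : Fin n) (t : ℕ) : Fin m → ℝ :=
  if h0 : t = 0 then w0 x
  else if h1 : t ≤ n then
    let i : Fin n := ⟨t - 1, by omega⟩
    u (i, g i)
  else if h2 : t ≤ 2 * n then
    let i : Fin n := ⟨t - n - 1, by omega⟩
    v (i, f i)
  else wq

/-- Running the SSM recurrence on a token stream: `ssmRun … 0 = 0` is the state
`h_{-1}` before any token, and `ssmRun … (t+1) = A(tok t) · (ssmRun … t) + B(tok t) · tok t`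
is the state `h_t` after processing token `t`. -/
def ssmRun {d m : ℕ} (A : (Fin m → ℝ) → Matrix (Fin d) (Fin d) ℝ)
    (B : (Fin m → ℝ) → Matrix (Fin d) (Fin m) ℝ)
    (tok : ℕ → Fin m → ℝ) : ℕ → Fin d → ℝ
  | 0 => 0
  | t + 1 => A (tok t) *ᵥ ssmRun A B tok t + B (tok t) *ᵥ tok t

/-- The matrix `𝒜(f) = A(t_{2n}) · A(t_{2n−1}) ⋯ A(t_{n+1})`, where
`t_{n+1+i} = v(i, f i)`; it depends only on `f`. -/
def fcMat {n d m : ℕ} (A : (Fin m → ℝ) → Matrix (Fin d) (Fin d) ℝ)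
    (v : Fin n × Fin n → Fin m → ℝ) (f : Fin n → Fin n) :
    Matrix (Fin d) (Fin d) ℝ :=
  (((List.finRange n).reverse.map fun i => A (v (i, f i))).prod)

/-- The vector `b(f) = ∑_{i=1}^{n} (A(t_{2n}) ⋯ A(t_{n+i+1})) · B(t_{n+i}) · t_{n+i}`,
where `t_{n+1+i} = v(i, f i)`; it depends only on `f`. -/
def fcVec {n d m : ℕ} (A : (Fin m → ℝ) → Matrix (Fin d) (Fin d) ℝ)
    (B : (Fin m → ℝ) → Matrix (Fin d) (Fin m) ℝ)
    (v : Fin n × Fin n → Fin m → ℝ) (f : Fin n → Fin n) : Fin d → ℝ :=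
  ∑ j : Fin n,
    ((((List.finRange n).reverse.filter fun i => decide (j < i)).map
        fun i => A (v (i, f i))).prod) *ᵥ
      (B (v (j, f j)) *ᵥ v (j, f j))

/-- Closed form of an affine recurrence of length `n`. -/
theorem affine_recurrence_closed_form {d : ℕ} :
    ∀ (n : ℕ) (a : Fin n → Matrix (Fin d) (Fin d) ℝ) (c : Fin n → Fin d → ℝ)
      (h : ℕ → Fin d → ℝ), (∀ i : Fin n, h (i + 1) = a i *ᵥ h i + c i) →
      h n = ((List.finRange n).reverse.map a).prod *ᵥ h 0 +
        ∑ j : Fin n, (((List.finRange n).reverse.filter fun i => decide (j < i)).map a).prod *ᵥ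
          c j := by
  intro n
  induction n with
  | zero => intro a c h _; simp
  | succ n ih =>
    intro a c h hh
    have hstep := hh (Fin.last n)
    have hprev := ih (fun i => a i.castSucc) (fun i => c i.castSucc) h
      (fun i => by simpa using hh i.castSucc)
    have hlast : ((List.finRange n).reverse.map Fin.castSucc).filter
        (fun i => decide (Fin.last n < i)) = [] := by
      simp [List.filter_eq_nil_iff, Fin.le_last]
    have hfilter : ∀ j : Fin n, ((List.finRange n).reverse.map Fin.castSucc).filter
        (fun i => decide (j.castSucc < i)) =
        ((List.finRange n).reverse.filter fun i => decide (j < i)).map Fin.castSucc := by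
      intro j
      rw [List.filter_map]
      rfl
    simp only [Fin.val_last] at hstep
    rw [hstep, hprev, Fin.sum_univ_castSucc, List.finRange_succ_last, List.reverse_append,
      List.reverse_singleton, List.singleton_append, ← List.map_reverse]
    simp only [List.filter_cons, hfilter, hlast, Fin.castSucc_lt_last, lt_irrefl, decide_true,
      decide_false, if_true, Bool.false_eq_true, if_false, List.map_cons, List.prod_cons,
      List.map_nil, List.prod_nil, one_mulVec, List.map_map,
      ← mulVec_mulVec, mulVec_add, mulVec_sum, add_assoc]
    rfl

/-- The state of the recurrence depends only on the tokens read so far. -/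
theorem ssmRun_congr {d m : ℕ} (A : (Fin m → ℝ) → Matrix (Fin d) (Fin d) ℝ)
    (B : (Fin m → ℝ) → Matrix (Fin d) (Fin m) ℝ) {tok tok' : ℕ → Fin m → ℝ} {k : ℕ}
    (h : ∀ t < k, tok t = tok' t) : ssmRun A B tok k = ssmRun A B tok' k := by
  induction k with
  | zero => rfl
  | succ k ih =>
    simp only [ssmRun]
    rw [ih fun t ht => h t (ht.trans k.lt_succ_self), h k k.lt_succ_self]

/-- The final state depends on `f` only through `fcMat` and `fcVec`. -/
theorem ssmRun_fcPrompt {n d m : ℕ} (A : (Fin m → ℝ) → Matrix (Fin d) (Fin d) ℝ)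
    (B : (Fin m → ℝ) → Matrix (Fin d) (Fin m) ℝ)
    (u v : Fin n × Fin n → Fin m → ℝ) (w0 : Fin n → Fin m → ℝ) (wq : Fin m → ℝ)
    (f f₀ g : Fin n → Fin n) (x : Fin n) :
    ssmRun A B (fcPrompt n m u v w0 wq f g x) (2 * n + 2) =
      A wq *ᵥ (fcMat A v f *ᵥ ssmRun A B (fcPrompt n m u v w0 wq f₀ g x) (n + 1) +
        fcVec A B v f) + B wq *ᵥ wq := by
  have hprefix : ssmRun A B (fcPrompt n m u v w0 wq f g x) (n + 1) =
      ssmRun A B (fcPrompt n m u v w0 wq f₀ g x) (n + 1) := by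
    refine ssmRun_congr A B fun t ht => ?_
    have : t ≤ n := by omega
    simp [fcPrompt, this]
  have hquery : fcPrompt n m u v w0 wq f g x (2 * n + 1) = wq := by
    have : ¬ (2 * n + 1 ≤ n) := by omega
    simp [fcPrompt, this]
  have hblock := affine_recurrence_closed_form n (fun i => A (v (i, f i)))
    (fun i => B (v (i, f i)) *ᵥ v (i, f i))
    (fun k => ssmRun A B (fcPrompt n m u v w0 wq f g x) (n + 1 + k)) (fun i => by
      have htok : fcPrompt n m u v w0 wq f g x (n + 1 + i) = v (i, f i) := by
        have h0 : ¬ (n + 1 + (i : ℕ) = 0) := by omega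
        have h1 : ¬ (n + 1 + (i : ℕ) ≤ n) := by omega
        have h2 : n + 1 + (i : ℕ) ≤ 2 * n := by omega
        have h3 : n + 1 + (i : ℕ) - n - 1 = i := by omega
        simp only [fcPrompt, h0, h1, h2, h3, dite_true, dite_false]
      change ssmRun A B _ (n + 1 + i + 1) = _
      simp only [ssmRun, htok])
  rw [show 2 * n + 2 = (2 * n + 1) + 1 by ring, ssmRun, hquery,
    show 2 * n + 1 = n + 1 + n by ring]
  simp only [add_zero, hprefix] at hblock
  rw [hblock]
  rfl

/-- A Hamming ball of radius `t` in `ι → β` has at most `(|ι| · |β|) ^ t` elements. -/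
theorem card_hammingDist_le {ι β : Type*} [Fintype ι] [DecidableEq ι] [Nonempty ι] [Fintype β]
    [DecidableEq β] (c : ι → β) (t : ℕ) :
    (univ.filter fun f : ι → β => hammingDist c f ≤ t).card ≤
      (Fintype.card ι * Fintype.card β) ^ t := by
  induction t with
  | zero => simp [hammingDist_eq_zero, Finset.filter_eq]
  | succ t ih =>
    have hsub : (univ.filter fun f : ι → β => hammingDist c f ≤ t + 1) ⊆
        ((univ.filter fun f : ι → β => hammingDist c f ≤ t) ×ˢ (univ : Finset (ι × β))).image
          fun q => Function.update q.1 q.2.1 q.2.2 := by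
      intro f hf
      simp only [mem_filter, mem_univ, true_and] at hf
      simp only [mem_image, mem_product, mem_filter, mem_univ, true_and, and_true, Prod.exists]
      by_cases hcf : c = f
      · exact ⟨f, Classical.arbitrary ι, f (Classical.arbitrary ι), by simp [hcf], by simp⟩
      · obtain ⟨i, hi⟩ := Function.ne_iff.mp hcf
        refine ⟨Function.update f i (c i), i, f i, ?_, by simp⟩
        have hlt : hammingDist c (Function.update f i (c i)) < hammingDist c f := by
          refine card_lt_card (Finset.ssubset_iff_subset_ne.mpr ⟨fun j => ?_, fun h => ?_⟩)
          · by_cases hj : j = i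
            · subst hj; simp
            · simp [hj]
          · have : i ∈ univ.filter fun j => c j ≠ f j := by simpa using hi
            rw [← h] at this
            simp at this
        omega
    calc _ ≤ _ := card_le_card hsub
      _ ≤ _ := card_image_le
      _ ≤ _ := by
        rw [card_product, card_univ, Fintype.card_prod, pow_succ]
        exact Nat.mul_le_mul_right _ ih

/-- Total Hamming error of reconstructing all `f : ι → β` from a code with values in `α`. -/
theorem le_sum_hammingDist_code {ι β α : Type*} [Fintype ι] [DecidableEq ι] [Nonempty ι] [Fintype β]
    [DecidableEq β] [Fintype α] (code : (ι → β) → α) (P : α → ι → β) (T : ℕ) :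
    T * Fintype.card (ι → β) ≤ ∑ f, hammingDist (P (code f)) f +
      ∑ t ∈ range T, Fintype.card α * (Fintype.card ι * Fintype.card β) ^ t := by
  have hpoint : ∀ f : ι → β, T ≤ hammingDist (P (code f)) f +
      ∑ t ∈ range T, if hammingDist (P (code f)) f ≤ t then 1 else 0 := by
    intro f
    generalize hammingDist (P (code f)) f = D
    induction T with
    | zero => simp
    | succ T ih =>
      rw [sum_range_succ]
      split_ifs with h
      · omega
      · omega
  have hball : ∀ t, ∑ f : ι → β, (if hammingDist (P (code f)) f ≤ t then 1 else 0) ≤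
      Fintype.card α * (Fintype.card ι * Fintype.card β) ^ t := by
    intro t
    calc ∑ f : ι → β, (if hammingDist (P (code f)) f ≤ t then 1 else 0)
        ≤ ∑ f : ι → β, ∑ a : α, if hammingDist (P a) f ≤ t then 1 else 0 :=
          sum_le_sum fun f _ => single_le_sum
            (f := fun a : α => if hammingDist (P a) f ≤ t then 1 else 0)
            (fun _ _ => Nat.zero_le _) (mem_univ (code f))
      _ = ∑ a : α, (univ.filter fun f : ι → β => hammingDist (P a) f ≤ t).card := by
          rw [sum_comm]
          simp
      _ ≤ ∑ _a : α, (Fintype.card ι * Fintype.card β) ^ t :=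
          sum_le_sum fun a _ => card_hammingDist_le (P a) t
      _ = _ := by simp
  calc T * Fintype.card (ι → β) = ∑ _f : ι → β, T := by simp [mul_comm]
    _ ≤ _ := sum_le_sum fun f _ => hpoint f
    _ = _ := by rw [sum_add_distrib, sum_comm]
    _ ≤ _ := Nat.add_le_add_left (sum_le_sum fun t _ => hball t) _

/-- The truncated geometric tail bound obtained from the optimal truncation. -/
theorem exists_truncation {N ρ : ℝ} (hN : 2 ≤ N) (hρ : 0 < ρ) :
    ∃ T : ℕ, ρ / 3 ≤ T - ∑ t ∈ range T, N ^ (-ρ) * (N * N) ^ t := by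
  obtain ⟨k, hk⟩ : ∃ k : ℕ, ⌈ρ / 2⌉₊ = k + 1 :=
    Nat.exists_eq_succ_of_ne_zero (Nat.ceil_pos.mpr (by positivity)).ne'
  have hle : ρ / 2 ≤ k + 1 := by
    have := Nat.le_ceil (ρ / 2)
    rw [hk] at this
    exact_mod_cast this
  have hlt : (k : ℝ) < ρ / 2 := Nat.lt_ceil.mp (by omega)
  obtain ⟨s, hs⟩ : ∃ s, s = ρ / 2 - k := ⟨_, rfl⟩
  have hN0 : 0 < N := by linarith
  have hinv : (N * N)⁻¹ ≤ 1 / 4 := by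
    rw [inv_le_comm₀ (by positivity) (by norm_num)]
    nlinarith
  have hinv0 : 0 < (N * N)⁻¹ := by positivity
  have hy : N ^ (-ρ) * (N * N) ^ k = ((N * N)⁻¹) ^ s := by
    rw [← Real.rpow_natCast, Real.inv_rpow (by positivity), ← Real.rpow_neg (by positivity),
      ← pow_two, ← Real.rpow_natCast, ← Real.rpow_mul hN0.le, ← Real.rpow_mul hN0.le,
      ← Real.rpow_add hN0, hs]
    congr 1
    push_cast
    ring
  have hbern : ((N * N)⁻¹) ^ s ≤ 1 - 3 / 4 * s := by
    have := rpow_one_add_le_one_add_mul_self (s := (N * N)⁻¹ - 1) (by linarith)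
      (p := s) (by linarith) (by linarith)
    rw [add_sub_cancel] at this
    nlinarith
  have hgeom : ∀ j : ℕ, ∑ t ∈ range j, (N * N) ^ t ≤ (N * N) ^ j / 3 := by
    intro j
    induction j with
    | zero => simp
    | succ j ih =>
      rw [sum_range_succ, pow_succ]
      have hpos : 0 < (N * N) ^ j := by positivity
      have hsq : 4 ≤ N * N := by nlinarith
      nlinarith [mul_le_mul_of_nonneg_left hsq hpos.le]
  refine ⟨k + 1, ?_⟩
  rw [sum_range_succ, hy, ← mul_sum]
  have hc : 0 < N ^ (-ρ) := by positivity
  have htail : N ^ (-ρ) * ∑ t ∈ range k, (N * N) ^ t ≤ k / 3 := by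
    rcases Nat.eq_zero_or_pos k with rfl | hkpos
    · simp
    · have h1 := mul_le_mul_of_nonneg_left (hgeom k) hc.le
      rw [← mul_div_assoc, hy] at h1
      have : (1 : ℝ) ≤ k := by exact_mod_cast hkpos
      linarith
  push_cast
  linarith

/-- Function composition requires wide one-layer SSMs: with `R = n·log₂ n − (d²+d)·p ≥ 0`
and all entries of `𝒜(f)` and `b(f)` lying in a finite precision set `S` with
`|S| ≤ 2^p`, for every bijection `g` the SSM's answer `dec(h_{2n+1})` to the
query `f(g(x))` is wrong with probability at least `R/(3·n·log₂ n)` over a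
uniformly random `f : Fin n → Fin n` and uniformly random argument `x`. -/
theorem ssm_function_composition_lower_bound
    (n d p m : ℕ) (hn : 2 ≤ n) (hd : 0 < d) (hp : 0 < p) (hm : 0 < m)
    (R : ℝ) (hRdef : R = (n : ℝ) * Real.logb 2 n - (((d ^ 2 + d) * p : ℕ) : ℝ))
    (hR : 0 ≤ R)
    (S : Finset ℝ) (hS : S.card ≤ 2 ^ p)
    (A : (Fin m → ℝ) → Matrix (Fin d) (Fin d) ℝ)
    (B : (Fin m → ℝ) → Matrix (Fin d) (Fin m) ℝ)
    (u v : Fin n × Fin n → Fin m → ℝ)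
    (w0 : Fin n → Fin m → ℝ) (wq : Fin m → ℝ)
    (dec : (Fin d → ℝ) → Fin n)
    (hprecA : ∀ f : Fin n → Fin n, ∀ i j : Fin d, fcMat A v f i j ∈ S)
    (hprecb : ∀ f : Fin n → Fin n, ∀ i : Fin d, fcVec A B v f i ∈ S)
    (g : Fin n → Fin n) (hg : Function.Bijective g) :
    R / (3 * (n : ℝ) * Real.logb 2 n) ≤
      ((Finset.univ.filter fun q : (Fin n → Fin n) × Fin n =>
          dec (ssmRun A B (fcPrompt n m u v w0 wq q.1 g q.2) (2 * n + 2)) ≠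
            q.1 (g q.2)).card : ℝ) /
        (Fintype.card ((Fin n → Fin n) × Fin n) : ℝ) := by
  classical
  have : NeZero n := ⟨by omega⟩
  have hN : (2 : ℝ) ≤ n := by exact_mod_cast hn
  have hN0 : (0 : ℝ) < n := by linarith
  have hlog : 0 < Real.logb 2 n := Real.logb_pos (by norm_num) (by linarith)
  rcases hR.eq_or_lt with hR0 | hRpos
  · rw [← hR0, zero_div]
    positivity
  let e := Equiv.ofBijective g hg
  let code : (Fin n → Fin n) → (Fin d → Fin d → S) × (Fin d → S) := fun f =>
    (fun i j => ⟨fcMat A v f i j, hprecA f i j⟩, fun i => ⟨fcVec A B v f i, hprecb f i⟩)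
  let P : (Fin d → Fin d → S) × (Fin d → S) → Fin n → Fin n := fun a y =>
    dec (A wq *ᵥ (Matrix.of (fun i j => (a.1 i j : ℝ)) *ᵥ
      ssmRun A B (fcPrompt n m u v w0 wq id g (e.symm y)) (n + 1) +
        fun i => (a.2 i : ℝ)) + B wq *ᵥ wq)
  have hP : ∀ f x, dec (ssmRun A B (fcPrompt n m u v w0 wq f g x) (2 * n + 2)) =
      P (code f) (g x) := by
    intro f x
    have : e.symm (g x) = x := e.symm_apply_apply x
    simp only [P, this]
    rw [ssmRun_fcPrompt A B u v w0 wq f id g x]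
    rfl
  have hcount : (Finset.univ.filter fun q : (Fin n → Fin n) × Fin n =>
      dec (ssmRun A B (fcPrompt n m u v w0 wq q.1 g q.2) (2 * n + 2)) ≠ q.1 (g q.2)).card =
      ∑ f, hammingDist (P (code f)) f := by
    rw [card_filter, Fintype.sum_prod_type]
    refine sum_congr rfl fun f _ => ?_
    rw [hammingDist, card_filter]
    simp only [hP]
    exact e.sum_comp fun y => if P (code f) y ≠ f y then 1 else 0
  rw [hcount]
  obtain ⟨T, hT⟩ := exists_truncation (ρ := R / Real.logb 2 n) hN (by positivity)
  have hmain := le_sum_hammingDist_code code P T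
  have hcard : Fintype.card ((Fin d → Fin d → S) × (Fin d → S)) ≤ 2 ^ ((d ^ 2 + d) * p) := by
    simp only [Fintype.card_prod, Fintype.card_fun, Fintype.card_fin, Fintype.card_coe]
    rw [← pow_mul, ← pow_add, ← pow_two, mul_comm (d ^ 2 + d) p, pow_mul]
    exact Nat.pow_le_pow_left hS _
  have hpow : (2 : ℝ) ^ ((d ^ 2 + d) * p) =
      (n : ℝ) ^ n * (n : ℝ) ^ (-(R / Real.logb 2 n)) := by
    have h2 : (n : ℝ) = 2 ^ Real.logb 2 n :=
      (Real.rpow_logb (by norm_num) (by norm_num) hN0).symm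
    rw [← Real.rpow_natCast (n : ℝ) n, ← Real.rpow_add hN0, ← Real.rpow_natCast]
    conv_rhs => rw [h2]
    rw [← Real.rpow_mul (by norm_num), ← h2]
    congr 1
    field_simp
    rw [hRdef]
    ring
  simp only [Fintype.card_fun, Fintype.card_fin] at hmain
  have hmain' : (T : ℝ) * (n : ℝ) ^ n ≤ (∑ f, hammingDist (P (code f)) f : ℕ) +
      (n : ℝ) ^ n * ∑ t ∈ range T, (n : ℝ) ^ (-(R / Real.logb 2 n)) * ((n : ℝ) * n) ^ t := by
    have hcast := (Nat.cast_le (α := ℝ)).mpr hmain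
    rw [Nat.cast_add, Nat.cast_mul, Nat.cast_pow] at hcast
    refine hcast.trans ?_
    refine add_le_add_right ?_ _
    rw [mul_sum, Nat.cast_sum]
    refine sum_le_sum fun t _ => ?_
    rw [← mul_assoc, ← hpow]
    push_cast
    gcongr
    exact_mod_cast hcard
  simp only [Fintype.card_prod, Fintype.card_fun, Fintype.card_fin]
  push_cast at hmain' ⊢
  have hnn : (0 : ℝ) < (n : ℝ) ^ n := by positivity
  rw [le_div_iff₀ (by positivity)]
  calc R / (3 * n * Real.logb 2 n) * ((n : ℝ) ^ n * n)
      = (n : ℝ) ^ n * (R / Real.logb 2 n / 3) := by field_simp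
    _ ≤ (n : ℝ) ^ n * _ := mul_le_mul_of_nonneg_left hT hnn.le
    _ ≤ _ := by linarith
end

section
/- Let n ≥ 2 be a natural number and let R be a real number with 0 ≤ R ≤ n·log₂ n. Let M be a finite type with |M| ≤ 2^{n·log₂ n − R}, let enc : (Fin n → Fin n) → M be any encoding, and let dec : M → (Fin n → Fin n) be any decoding. Then the error probability, when f is sampled uniformly from the functions Fin n → Fin n and j is sampled uniformly from Fin n, satisfies Pr_{f, j}[ dec(enc f)(j) ≠ f(j) ] ≥ R/(3·n·log₂ n). Equivalently, (1/n^n)·Σ_f ( |{ j : dec(enc f)(j) ≠ f(j) }| / n ) ≥ R/(3·n·log₂ n). -/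
section HammingDistortion

variable {ι α M : Type*} [Fintype ι] [DecidableEq ι] [Fintype α] [DecidableEq α] [Fintype M]

/-- The generating function of Hamming distances from a fixed word. -/
theorem sum_pow_hammingDist {A : Type*} [CommRing A] (x : A) (g : ι → α) :
    ∑ f : ι → α, x ^ hammingDist g f =
      (1 + ((Fintype.card α : A) - 1) * x) ^ Fintype.card ι := by
  have hpow (f : ι → α) :
      x ^ hammingDist g f = ∏ j, if g j ≠ f j then x else 1 := by
    rw [Finset.prod_ite, Finset.prod_const, Finset.prod_const_one, mul_one]
    rfl
  have hcoord (j : ι) :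
      ∑ a : α, (if g j ≠ a then x else 1) = 1 + ((Fintype.card α : A) - 1) * x := by
    have hsplit (a : α) :
        (if g j ≠ a then x else 1) = x + if g j = a then 1 - x else 0 := by
      by_cases h : g j = a <;> simp [h]
    simp only [hsplit, Finset.sum_add_distrib, Finset.sum_ite_eq, Finset.mem_univ, if_true,
      Finset.sum_const, Finset.card_univ, nsmul_eq_mul]
    ring
  simp_rw [hpow]
  have h := Finset.prod_univ_sum (fun _ : ι => (Finset.univ : Finset α))
    (fun j a => if g j ≠ a then x else 1)
  rw [Fintype.piFinset_univ] at h
  rw [← h, Finset.prod_congr rfl fun j _ => hcoord j, Finset.prod_const, Finset.card_univ]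

theorem sum_pow_hammingDist_decode_le {x : ℝ} (hx : 0 ≤ x)
    (enc : (ι → α) → M) (dec : M → ι → α) :
    ∑ f, x ^ hammingDist (dec (enc f)) f ≤
      Fintype.card M * (1 + ((Fintype.card α : ℝ) - 1) * x) ^ Fintype.card ι := by
  calc ∑ f, x ^ hammingDist (dec (enc f)) f
      ≤ ∑ f, ∑ m, x ^ hammingDist (dec m) f := Finset.sum_le_sum fun f _ =>
        Finset.single_le_sum (f := fun m => x ^ hammingDist (dec m) f)
          (fun _ _ => pow_nonneg hx _) (Finset.mem_univ (enc f))
    _ = ∑ m, ∑ f, x ^ hammingDist (dec m) f := Finset.sum_comm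
    _ = _ := by simp [sum_pow_hammingDist]

/-- All but `card M` words are decoded with at least one error. -/
theorem card_sub_card_le_sum_hammingDist (enc : (ι → α) → M) (dec : M → ι → α) :
    (Fintype.card (ι → α) : ℝ) - Fintype.card M ≤
      ∑ f, (hammingDist (dec (enc f)) f : ℝ) := by
  have h0 := sum_pow_hammingDist_decode_le (x := 0) le_rfl enc dec
  rw [mul_zero, add_zero, one_pow, mul_one] at h0
  have h1 : ∑ f : ι → α, (1 : ℝ) ≤
      ∑ f, ((hammingDist (dec (enc f)) f : ℝ) + 0 ^ hammingDist (dec (enc f)) f) := by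
    refine Finset.sum_le_sum fun f _ => ?_
    rcases Nat.eq_zero_or_pos (hammingDist (dec (enc f)) f) with h | h
    · simp [h]
    · have : (1 : ℝ) ≤ hammingDist (dec (enc f)) f := by exact_mod_cast h
      simpa [h.ne'] using this
  rw [Finset.sum_add_distrib, Finset.sum_const, Finset.card_univ, nsmul_eq_mul, mul_one] at h1
  linarith

end HammingDistortion

/-- Jensen's inequality for the exponential and a uniform average. -/
theorem card_mul_exp_average_le_sum_exp {β : Type*} [Fintype β] [Nonempty β] (u : β → ℝ) :
    Fintype.card β * Real.exp ((∑ b, u b) / Fintype.card β) ≤ ∑ b, Real.exp (u b) := by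
  have hN : (Fintype.card β : ℝ) ≠ 0 := by exact_mod_cast Fintype.card_ne_zero
  set a := (∑ b, u b) / Fintype.card β with ha
  have hsum : ∑ b, u b = Fintype.card β * a := by rw [ha]; field_simp
  calc Fintype.card β * Real.exp a = ∑ b, Real.exp a * (u b - a + 1) := by
        rw [← Finset.mul_sum, Finset.sum_add_distrib, Finset.sum_sub_distrib, hsum]
        simp [mul_comm]
    _ ≤ ∑ b, Real.exp (u b) := Finset.sum_le_sum fun b _ => by
        calc Real.exp a * (u b - a + 1) ≤ Real.exp a * Real.exp (u b - a) := by
              gcongr; exact Real.add_one_le_exp _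
          _ = Real.exp (u b) := by rw [← Real.exp_add]; ring_nf

/-- The chord of `t ↦ 1 - exp (-t)` over `[0, s]` lies below its graph. -/
theorem mul_one_sub_exp_neg_le {r s : ℝ} (hr : 0 ≤ r) (hrs : r ≤ s) :
    r * (1 - Real.exp (-s)) ≤ s * (1 - Real.exp (-r)) := by
  rcases hr.eq_or_lt with rfl | hr
  · simp
  have hs : 0 < s := hr.trans_le hrs
  have h := convexOn_exp.2 (Set.mem_univ (-s)) (Set.mem_univ 0)
    (div_nonneg hr.le hs.le) (sub_nonneg.2 ((div_le_one hs).2 hrs)) (by ring)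
  have harg : (r / s) • (-s) + (1 - r / s) • (0 : ℝ) = -r := by
    simp only [smul_eq_mul]; field_simp; ring
  rw [harg, smul_eq_mul, smul_eq_mul, Real.exp_zero] at h
  have h' := mul_le_mul_of_nonneg_left h hs.le
  have hexp : s * (r / s * Real.exp (-s) + (1 - r / s) * 1) =
      r * Real.exp (-s) + s - r := by field_simp; ring
  linarith

theorem thirteen_twelfths_le_log_three : (13 / 12 : ℝ) ≤ Real.log 3 := by
  have he : Real.exp 1 ^ 13 ≤ (3 : ℝ) ^ 12 :=
    (pow_le_pow_left₀ (Real.exp_pos 1).le (Real.exp_one_lt_d9.le.trans (by norm_num :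
      (2.7182818286 : ℝ) ≤ 2.71829)) 13).trans (by norm_num)
  have h := Real.log_le_log (by positivity) he
  rw [Real.log_pow, Real.log_pow, Real.log_exp] at h
  norm_num at h
  linarith

theorem exp_neg_three_le : Real.exp (-3) ≤ 1 / 20 := by
  have h : (20 : ℝ) ≤ Real.exp 1 ^ 3 := (by norm_num : (20 : ℝ) ≤ 2.718 ^ 3).trans
    (pow_le_pow_left₀ (by norm_num) ((by norm_num : (2.718 : ℝ) ≤ 2.7182818283).trans
      Real.exp_one_gt_d9.le) 3)
  rw [← Real.exp_nat_mul] at h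
  norm_num at h
  rw [Real.exp_neg, ← one_div]
  exact one_div_le_one_div_of_le (by norm_num) h

/-- A distortion-rate trade-off: `r` is the rate loss in nats and `d` the expected number of
wrongly decoded coordinates. -/
theorem rate_loss_le_of_average_hammingDist {n : ℕ} (hn : 1 ≤ n) {M : Type*} [Fintype M] {r : ℝ}
    (hM : (Fintype.card M : ℝ) ≤ (n : ℝ) ^ n * Real.exp (-r))
    (enc : (Fin n → Fin n) → M) (dec : M → Fin n → Fin n) :
    r ≤ 2 * ((∑ f, (hammingDist (dec (enc f)) f : ℝ)) / (n : ℝ) ^ n) * Real.log n + 1 := by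
  have hn1 : (1 : ℝ) ≤ n := by exact_mod_cast hn
  have hn0 : (0 : ℝ) < n := by linarith
  have : Nonempty (Fin n) := ⟨⟨0, hn⟩⟩
  set d := (∑ f, (hammingDist (dec (enc f)) f : ℝ)) / (n : ℝ) ^ n with hd
  set x := Real.exp (-(2 * Real.log n)) with hx
  have hxn : x = 1 / (n : ℝ) ^ 2 := by
    rw [hx, Real.exp_neg, two_mul, Real.exp_add, Real.exp_log hn0, one_div, sq]
  have hball : (1 + ((n : ℝ) - 1) * x) ^ n ≤ Real.exp 1 := by
    have hle : 1 + ((n : ℝ) - 1) * x ≤ Real.exp (1 / n) := by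
      refine le_trans ?_ (Real.add_one_le_exp _)
      have : ((n : ℝ) - 1) * x ≤ n * x := by
        have := (Real.exp_pos (-(2 * Real.log n))).le
        nlinarith
      have h2 : (n : ℝ) * x = 1 / n := by rw [hxn]; field_simp
      linarith
    have h0 : 0 ≤ 1 + ((n : ℝ) - 1) * x := by
      have := mul_nonneg (sub_nonneg.2 hn1) (Real.exp_pos (-(2 * Real.log n))).le
      linarith
    calc _ ≤ Real.exp (1 / n) ^ n := pow_le_pow_left₀ h0 hle n
      _ = Real.exp 1 := by rw [← Real.exp_nat_mul]; congr 1; field_simp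
  have hupper := sum_pow_hammingDist_decode_le (Real.exp_pos (-(2 * Real.log n))).le enc dec
  have hlower := card_mul_exp_average_le_sum_exp
    fun f => (hammingDist (dec (enc f)) f : ℝ) * -(2 * Real.log n)
  simp only [Real.exp_nat_mul, ← Finset.sum_mul, Fintype.card_fun, Fintype.card_fin,
    Nat.cast_pow] at hlower hupper
  rw [mul_div_right_comm, ← hd] at hlower
  have hchain : (n : ℝ) ^ n * Real.exp (d * -(2 * Real.log n)) ≤
      (n : ℝ) ^ n * Real.exp (-r + 1) := by
    rw [Real.exp_add, ← mul_assoc]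
    exact (hlower.trans hupper).trans
      (mul_le_mul hM hball (pow_nonneg (by
        have := mul_nonneg (sub_nonneg.2 hn1) (Real.exp_pos (-(2 * Real.log n))).le
        linarith) n) (by positivity))
  have h := Real.exp_le_exp.1 (le_of_mul_le_mul_left hchain (by positivity))
  linarith

/-- For small rate loss, the probability of not decoding perfectly already suffices. -/
theorem le_three_mul_one_sub_exp_neg_mul_log {n : ℕ} (hn : 2 ≤ n) {r : ℝ} (hr0 : 0 ≤ r)
    (hr : r ≤ n * Real.log n) (hr3 : r ≤ 3) :
    r ≤ 3 * (1 - Real.exp (-r)) * Real.log n := by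
  have hq : 0 ≤ 1 - Real.exp (-r) := by
    have : Real.exp (-r) ≤ 1 := Real.exp_le_one_iff.2 (by linarith)
    linarith
  rcases hn.eq_or_lt with rfl | hn
  · have h := mul_one_sub_exp_neg_le hr0 hr
    have he : Real.exp (-(((2 : ℕ) : ℝ) * Real.log (2 : ℕ))) = 1 / 4 := by
      rw [Real.exp_neg, Real.exp_nat_mul, Real.exp_log (by norm_num)]
      norm_num
    rw [he] at h
    have := mul_nonneg hq (Real.log_nonneg (by norm_num : (1 : ℝ) ≤ (2 : ℕ)))
    push_cast at *
    linarith
  · have h := mul_one_sub_exp_neg_le hr0 hr3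
    have hlog : (13 / 12 : ℝ) ≤ Real.log n := thirteen_twelfths_le_log_three.trans
      (Real.log_le_log (by norm_num) (by exact_mod_cast hn))
    have h1 := mul_le_mul_of_nonneg_left exp_neg_three_le hr0
    have h2 := mul_le_mul_of_nonneg_left hlog hq
    linarith

/-- Communication lower bound for one-shot encoding of a random function
`f : Fin n → Fin n` into a message space `M` of size at most
`2 ^ (n·log₂ n − R)`: the average error probability at a uniform query
point is at least `R / (3·n·log₂ n)`. -/
theorem encoding_error_lower_bound
    (n : ℕ) (hn : 2 ≤ n) (R : ℝ) (hR0 : 0 ≤ R)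
    (hR1 : R ≤ (n : ℝ) * Real.logb 2 n)
    (M : Type*) [Fintype M]
    (hM : (Fintype.card M : ℝ) ≤ (2 : ℝ) ^ ((n : ℝ) * Real.logb 2 n - R))
    (enc : (Fin n → Fin n) → M) (dec : M → (Fin n → Fin n)) :
    R / (3 * (n : ℝ) * Real.logb 2 n) ≤
      (1 / (n : ℝ) ^ n) * ∑ f : Fin n → Fin n,
        (((Finset.univ.filter fun j : Fin n => dec (enc f) j ≠ f j).card : ℝ) / (n : ℝ)) := by
  have hn0 : (0 : ℝ) < n := by exact_mod_cast (by omega : 0 < n)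
  have hL : 0 < Real.log n := Real.log_pos (by exact_mod_cast (by omega : 1 < n))
  have hl2 : 0 < Real.log 2 := Real.log_pos (by norm_num)
  have hlogb : Real.logb 2 n * Real.log 2 = Real.log n := by
    rw [Real.logb]; field_simp
  set r := R * Real.log 2 with hr
  have hr0 : 0 ≤ r := by positivity
  have hr1 : r ≤ n * Real.log n := by
    rw [← hlogb, ← mul_assoc]
    exact mul_le_mul_of_nonneg_right hR1 hl2.le
  have hM' : (Fintype.card M : ℝ) ≤ (n : ℝ) ^ n * Real.exp (-r) := by
    refine hM.trans_eq ?_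
    rw [Real.rpow_def_of_pos (by norm_num), ← Real.exp_log (pow_pos hn0 n), ← Real.exp_add,
      Real.log_pow, ← hlogb, hr]
    ring_nf
  have hN : (0 : ℝ) < (n : ℝ) ^ n := by positivity
  set d := (∑ f, (hammingDist (dec (enc f)) f : ℝ)) / (n : ℝ) ^ n with hd
  have hrd : r ≤ 3 * d * Real.log n := by
    rcases le_total r 3 with h3 | h3
    · refine (le_three_mul_one_sub_exp_neg_mul_log hn hr0 hr1 h3).trans ?_
      have hcard := card_sub_card_le_sum_hammingDist enc dec
      simp only [Fintype.card_fun, Fintype.card_fin, Nat.cast_pow] at hcard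
      have : 1 - Real.exp (-r) ≤ d := by
        rw [hd, le_div_iff₀ hN]
        linarith
      gcongr
    · have h := rate_loss_le_of_average_hammingDist (by omega : 1 ≤ n) hM' enc dec
      rw [← hd] at h
      linarith
  have hlogb0 : 0 < Real.logb 2 n := by rw [Real.logb]; positivity
  have hR : R ≤ 3 * d * Real.logb 2 n := by
    refine le_of_mul_le_mul_right ?_ hl2
    rwa [mul_assoc, hlogb]
  have hrhs : (1 / (n : ℝ) ^ n) * ∑ f : Fin n → Fin n,
      (((Finset.univ.filter fun j : Fin n => dec (enc f) j ≠ f j).card : ℝ) / (n : ℝ)) =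
      d / n := by
    rw [hd, ← Finset.sum_div]
    simp only [hammingDist]
    ring
  rw [hrhs, div_le_div_iff₀ (by positivity) hn0]
  have := mul_le_mul_of_nonneg_right hR hn0.le
  linarith
end

section
/- Let K be a finite commutative ring, let d, m be positive natural numbers, let Σ be a finite alphabet with at least two elements, with a token embedding e : Σ → (Fin m → K), matrices A : Σ → Matrix (Fin d) (Fin d) K and B : Σ → Matrix (Fin d) (Fin m) K, and initial hidden state h₀ : Fin d → K; on a word w = σ₁⋯σ_N the SSM computes h_t = A(σ_t)·h_{t−1} + B(σ_t)·e(σ_t) and accepts w iff h_N ≠ 0. Then the language accepted by this SSM is not equal to the language of palindromes { w : List Σ | w.reverse = w }. -/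
open Matrix

theorem List.replicate_append_cons_inj {α : Type*} {a b : α} (hab : a ≠ b) :
    ∀ {i j : ℕ} {u v : List α},
      replicate i a ++ b :: u = replicate j a ++ b :: v → i = j
  | 0, 0, _, _, _ => rfl
  | 0, j + 1, _, _, h => by
    simp only [replicate_zero, nil_append, replicate_succ, cons_append, cons.injEq] at h
    exact absurd h.1.symm hab
  | i + 1, 0, _, _, h => by
    simp only [replicate_zero, nil_append, replicate_succ, cons_append, cons.injEq] at h
    exact absurd h.1 hab
  | i + 1, j + 1, _, _, h => by
    simp only [replicate_succ, cons_append, cons.injEq, true_and] at h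
    exact congrArg (· + 1) (replicate_append_cons_inj hab h)

/-- A deterministic left-to-right recurrence on a finite state space cannot recognize the
palindromes over an alphabet with at least two letters. -/
theorem List.setOf_foldl_ne_setOf_reverse_eq {S Γ : Type*} [Finite S] [Nontrivial Γ]
    (f : S → Γ → S) (s : S) (P : S → Prop) :
    {w : List Γ | P (w.foldl f s)} ≠ {w : List Γ | w.reverse = w} := by
  intro heq
  obtain ⟨a, b, hab⟩ := exists_pair_ne Γ
  obtain ⟨i, j, hij, hs⟩ := Finite.exists_ne_map_eq_of_infinite
    fun n : ℕ => (List.replicate n a).foldl f s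
  have h (w : List Γ) : P (w.foldl f s) ↔ w.reverse = w := Set.ext_iff.mp heq w
  have hi := (h (replicate i a ++ b :: replicate i a)).mpr (by simp)
  rw [foldl_append, hs, ← foldl_append, h] at hi
  refine hij (replicate_append_cons_inj hab (u := replicate j a) (v := replicate i a) ?_)
  simpa using hi

/-- No finite-precision SSM over a finite commutative ring accepts exactly the
language of palindromes over an alphabet with at least two letters. -/
theorem ssm_cannot_recognize_palindromes
    {K : Type} [CommRing K] [Fintype K] [DecidableEq K]
    (d m : ℕ) (hd : 0 < d) (hm : 0 < m)
    {Γ : Type} [Fintype Γ] (hΓ : 2 ≤ Fintype.card Γ)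
    (e : Γ → Fin m → K)
    (A : Γ → Matrix (Fin d) (Fin d) K) (B : Γ → Matrix (Fin d) (Fin m) K)
    (h0 : Fin d → K) :
    {w : List Γ | w.foldl (fun h σ => A σ *ᵥ h + B σ *ᵥ e σ) h0 ≠ 0} ≠
      {w : List Γ | w.reverse = w} := by
  have : Nontrivial Γ := Fintype.one_lt_card_iff_nontrivial.mp hΓ
  exact List.setOf_foldl_ne_setOf_reverse_eq _ h0 (· ≠ 0)
end

section
/- Let K be a finite commutative ring, let d, m be positive natural numbers, let Σ = Bool (with true read as an opening parenthesis and false as a closing parenthesis), with a token embedding e : Σ → (Fin m → K), matrices A : Σ → Matrix (Fin d) (Fin d) K and B : Σ → Matrix (Fin d) (Fin m) K, and initial hidden state h₀ : Fin d → K; on a word w = σ₁⋯σ_N the SSM computes h_t = A(σ_t)·h_{t−1} + B(σ_t)·e(σ_t) and accepts w iff h_N ≠ 0. Then the language accepted by this SSM is not equal to the balanced-parentheses (Dyck) language { w : List Bool | (number of true in w) = (number of false in w), and in every prefix of w the number of true is ≥ the number of false }. -/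
open Matrix

/-- Opening `n` parentheses and then closing them all gives a balanced word. -/
theorem replicate_append_replicate_balanced (n : ℕ) :
    (List.replicate n true ++ List.replicate n false).count true =
        (List.replicate n true ++ List.replicate n false).count false ∧
      ∀ t : List Bool, t <+: List.replicate n true ++ List.replicate n false →
        t.count false ≤ t.count true := by
  refine ⟨by simp [List.count_replicate], fun t ht => ?_⟩
  rw [List.prefix_iff_eq_take] at ht
  rw [ht]
  simp only [List.take_append, List.take_replicate, List.count_append, List.count_replicate,
    List.length_replicate]
  simp

/-- No finite-precision SSM over a finite commutative ring accepts exactly the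
Dyck language of balanced parentheses over `Bool` (`true` = '(', `false` = ')'). -/
theorem ssm_cannot_recognize_balanced_parentheses
    {K : Type} [CommRing K] [Fintype K] [DecidableEq K]
    (d m : ℕ) (hd : 0 < d) (hm : 0 < m)
    (e : Bool → Fin m → K)
    (A : Bool → Matrix (Fin d) (Fin d) K) (B : Bool → Matrix (Fin d) (Fin m) K)
    (h0 : Fin d → K) :
    {w : List Bool | w.foldl (fun h σ => A σ *ᵥ h + B σ *ᵥ e σ) h0 ≠ 0} ≠
      {w : List Bool | w.count true = w.count false ∧
        ∀ t : List Bool, t <+: w → t.count false ≤ t.count true} := by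
  intro heq
  obtain ⟨i, j, hij, hstate⟩ := Finite.exists_ne_map_eq_of_infinite fun n : ℕ =>
    (List.replicate n true).foldl (fun h σ => A σ *ᵥ h + B σ *ᵥ e σ) h0
  have hi : List.replicate i true ++ List.replicate i false ∈
      {w : List Bool | w.foldl (fun h σ => A σ *ᵥ h + B σ *ᵥ e σ) h0 ≠ 0} := by
    rw [heq]
    exact replicate_append_replicate_balanced i
  have hj : List.replicate j true ++ List.replicate i false ∈
      {w : List Bool | w.foldl (fun h σ => A σ *ᵥ h + B σ *ᵥ e σ) h0 ≠ 0} := by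
    simp only [Set.mem_ofPred_eq, List.foldl_append] at hi hstate ⊢
    rwa [← hstate]
  rw [heq] at hj
  have hcount := hj.1
  simp [List.count_replicate] at hcount
  exact hij hcount.symm
end
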